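/- Let r1, s1, r2, s2 be nonzero integers, x2, y2 integers and D1, D2 positive integers. Then Ŝ_{r1,s1,r2,s2}(0, 0, x2, y2; D1, D2) = 0 unless D1/gcd(D1, r1·s1) divides both x2 and y2. Similarly, for integers x1, y1, Ŝ_{r1,s1,r2,s2}(x1, y1, 0, 0; D1, D2) = 0 unless D2/gcd(D2, r2·s2) divides both x1 and y1. -/

import Mathlib

open MeasureTheory Finset Set
open scoped Real

noncomputable section

/-- `e(x) = exp(2πi x)`. -/
def eFn (x : ℝ) : ℂ := Complex.exp (2 * (Real.pi : ℂ) * Complex.I * (x : ℂ))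

open Classical in
/-- A choice of a Bézout pair `(Y, Z)` with `Y·B + Z·C ≡ 1 (mod D)`, when one exists
(the Kloosterman sum below does not depend on this choice). -/
def bezout (B C : ℤ) (D : ℕ) : ℤ × ℤ :=
  if h : ∃ p : ℤ × ℤ, (p.1 * B + p.2 * C) % (D : ℤ) = 1 % (D : ℤ) then h.choose else (0, 0)

/-- The long-Weyl-element GL(3) Kloosterman sum
`S(n₁,m₂,m₁,n₂;D₁,D₂) = Σ e((n₁B₁ + m₁(Y₁D₂ − Z₁B₂))/D₁ + (m₂B₂ + n₂(Y₂D₁ − Z₂B₁))/D₂)`,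
the sum running over `B₁, C₁ mod D₁` and `B₂, C₂ mod D₂` subject to
`D₁C₂ + B₁B₂ + D₂C₁ ≡ 0 mod D₁D₂` and `(Bⱼ, Cⱼ, Dⱼ) = 1`, with `YⱼBⱼ + ZⱼCⱼ ≡ 1 mod Dⱼ`. -/
def longS (n1 m2 m1 n2 : ℤ) (D1 D2 : ℕ) : ℂ :=
  ∑ B1 ∈ Finset.range D1, ∑ C1 ∈ Finset.range D1,
    ∑ B2 ∈ Finset.range D2, ∑ C2 ∈ Finset.range D2,
      if (D1 * D2 ∣ D1 * C2 + B1 * B2 + D2 * C1)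
          ∧ Nat.gcd (Nat.gcd B1 C1) D1 = 1 ∧ Nat.gcd (Nat.gcd B2 C2) D2 = 1 then
        eFn (((n1 * (B1 : ℤ) + m1 * ((bezout (B1 : ℤ) (C1 : ℤ) D1).1 * (D2 : ℤ)
                - (bezout (B1 : ℤ) (C1 : ℤ) D1).2 * (B2 : ℤ)) : ℤ) : ℝ) / (D1 : ℝ)
          + ((m2 * (B2 : ℤ) + n2 * ((bezout (B2 : ℤ) (C2 : ℤ) D2).1 * (D1 : ℤ)
                - (bezout (B2 : ℤ) (C2 : ℤ) D2).2 * (B1 : ℤ)) : ℤ) : ℝ) / (D2 : ℝ))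
      else 0

/-- The finite Fourier transform
`Ŝ_{r₁,s₁,r₂,s₂}(x₁,y₁,x₂,y₂;D₁,D₂) = (1/(D₁²D₂²)) Σ_{n₁,m₁ mod D₁} Σ_{n₂,m₂ mod D₂}
  S(n₁r₁, m₂r₂, m₁s₁, n₂s₂; D₁, D₂) e(−(x₁m₁ + y₁n₁)/D₁ − (x₂m₂ + y₂n₂)/D₂)`. -/
def Shat (r1 s1 r2 s2 : ℤ) (x1 y1 x2 y2 : ℤ) (D1 D2 : ℕ) : ℂ :=
  (1 / ((D1 : ℂ) ^ 2 * (D2 : ℂ) ^ 2)) *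
    ∑ n1 ∈ Finset.range D1, ∑ m1 ∈ Finset.range D1,
      ∑ n2 ∈ Finset.range D2, ∑ m2 ∈ Finset.range D2,
        longS ((n1 : ℤ) * r1) ((m2 : ℤ) * r2) ((m1 : ℤ) * s1) ((n2 : ℤ) * s2) D1 D2 *
          eFn (-(((x1 * (m1 : ℤ) + y1 * (n1 : ℤ) : ℤ) : ℝ) / (D1 : ℝ))
            - ((x2 * (m2 : ℤ) + y2 * (n2 : ℤ) : ℤ) : ℝ) / (D2 : ℝ))

lemma eFn_add (x y : ℝ) : eFn (x + y) = eFn x * eFn y := by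
  unfold eFn
  rw [← Complex.exp_add]
  congr 1
  push_cast
  ring

lemma eFn_nat_mul (n : ℕ) (x : ℝ) : eFn (n * x) = eFn x ^ n := by
  unfold eFn
  rw [← Complex.exp_nat_mul]
  congr 1
  push_cast
  ring

lemma eFn_int (n : ℤ) : eFn n = 1 := by
  unfold eFn
  rw [Complex.exp_eq_one_iff]
  exact ⟨n, by push_cast; ring⟩

lemma geom_zero (D : ℕ) (hD : 0 < D) (a : ℤ) (ha : ¬ (D : ℤ) ∣ a) :
    ∑ n ∈ Finset.range D, eFn (n * ((a : ℝ) / D)) = 0 := by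
  have hD' : (D : ℝ) ≠ 0 := by positivity
  simp_rw [eFn_nat_mul]
  have h1 : eFn ((a : ℝ) / D) ≠ 1 := by
    intro h
    unfold eFn at h
    rw [Complex.exp_eq_one_iff] at h
    obtain ⟨k, hk⟩ := h
    apply ha
    have h2 : (((a : ℝ) / D : ℝ) : ℂ) = ((k : ℝ) : ℂ) := by
      have h3 := Complex.two_pi_I_ne_zero
      apply mul_left_cancel₀ h3
      rw [hk]
      push_cast
      ring
    have h4 : (a : ℝ) / D = k := Complex.ofReal_injective h2
    rw [div_eq_iff hD'] at h4
    exact ⟨k, by rw [mul_comm]; exact_mod_cast h4⟩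
  rw [geom_sum_eq h1, ← eFn_nat_mul, mul_div_cancel₀ _ hD', eFn_int]
  simp

lemma four_zero (D1 D2 : ℕ) (hD1 : 0 < D1) (hD2 : 0 < D2) (a b c d : ℤ)
    (h : ¬ ((D1 : ℤ) ∣ a ∧ (D1 : ℤ) ∣ b ∧ (D2 : ℤ) ∣ c ∧ (D2 : ℤ) ∣ d)) :
    ∑ n1 ∈ Finset.range D1, ∑ m1 ∈ Finset.range D1,
      ∑ n2 ∈ Finset.range D2, ∑ m2 ∈ Finset.range D2,
        eFn (n1 * ((a : ℝ) / D1)) * (eFn (m1 * ((b : ℝ) / D1)) *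
          (eFn (n2 * ((c : ℝ) / D2)) * eFn (m2 * ((d : ℝ) / D2)))) = 0 := by
  simp_rw [← Finset.mul_sum, ← Finset.sum_mul]
  by_cases ha : (D1 : ℤ) ∣ a
  · by_cases hb : (D1 : ℤ) ∣ b
    · by_cases hc : (D2 : ℤ) ∣ c
      · have hd : ¬ (D2 : ℤ) ∣ d := fun hd => h ⟨ha, hb, hc, hd⟩
        rw [geom_zero D2 hD2 d hd]; simp
      · rw [geom_zero D2 hD2 c hc]; simp
    · rw [geom_zero D1 hD1 b hb]; simp
  · rw [geom_zero D1 hD1 a ha]; simp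

lemma swap1 (s e f g h : Finset ℕ) (F : ℕ → ℕ → ℕ → ℕ → ℕ → ℂ) :
    ∑ x ∈ s, ∑ i ∈ e, ∑ j ∈ f, ∑ k ∈ g, ∑ l ∈ h, F x i j k l =
    ∑ i ∈ e, ∑ j ∈ f, ∑ k ∈ g, ∑ l ∈ h, ∑ x ∈ s, F x i j k l := by
  rw [Finset.sum_comm]
  refine Finset.sum_congr rfl fun i _ => ?_
  rw [Finset.sum_comm]
  refine Finset.sum_congr rfl fun j _ => ?_
  rw [Finset.sum_comm]
  refine Finset.sum_congr rfl fun k _ => ?_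
  rw [Finset.sum_comm]

lemma swap4 (s t u v e f g h : Finset ℕ) (F : ℕ → ℕ → ℕ → ℕ → ℕ → ℕ → ℕ → ℕ → ℂ) :
    ∑ x ∈ s, ∑ y ∈ t, ∑ z ∈ u, ∑ w ∈ v,
      ∑ i ∈ e, ∑ j ∈ f, ∑ k ∈ g, ∑ l ∈ h, F x y z w i j k l =
    ∑ i ∈ e, ∑ j ∈ f, ∑ k ∈ g, ∑ l ∈ h,
      ∑ x ∈ s, ∑ y ∈ t, ∑ z ∈ u, ∑ w ∈ v, F x y z w i j k l := by
  have A3 : ∀ x y z, _ := fun x y z => swap1 v e f g h (fun w i j k l => F x y z w i j k l)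
  have A2 : ∀ x y, _ := fun x y =>
    swap1 u e f g h (fun z i j k l => ∑ w ∈ v, F x y z w i j k l)
  have A1 : ∀ x, _ := fun x =>
    swap1 t e f g h (fun y i j k l => ∑ z ∈ u, ∑ w ∈ v, F x y z w i j k l)
  have A0 := swap1 s e f g h (fun x i j k l => ∑ y ∈ t, ∑ z ∈ u, ∑ w ∈ v, F x y z w i j k l)
  rw [← A0]
  refine Finset.sum_congr rfl fun x _ => ?_
  rw [← A1 x]
  refine Finset.sum_congr rfl fun y _ => ?_
  rw [← A2 x y]
  refine Finset.sum_congr rfl fun z _ => ?_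
  rw [← A3 x y z]

lemma bezout_spec (B C D : ℕ) (h : Nat.gcd (Nat.gcd B C) D = 1) :
    (D : ℤ) ∣ (bezout B C D).1 * B + (bezout B C D).2 * C - 1 := by
  have hex : ∃ p : ℤ × ℤ, (p.1 * (B : ℤ) + p.2 * (C : ℤ)) % (D : ℤ) = 1 % (D : ℤ) := by
    have h1 := Nat.gcd_eq_gcd_ab B C
    have h2 := Nat.gcd_eq_gcd_ab (Nat.gcd B C) D
    rw [h] at h2
    set u := Nat.gcdA (Nat.gcd B C) D
    set v := Nat.gcdB (Nat.gcd B C) D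
    refine ⟨(u * Nat.gcdA B C, u * Nat.gcdB B C), ?_⟩
    apply Int.ModEq.symm
    rw [Int.modEq_iff_dvd]
    refine ⟨-v, ?_⟩
    push_cast at h2
    rw [h1] at h2
    linear_combination -h2
  have hs : bezout B C D = hex.choose := by
    unfold bezout
    rw [dif_pos hex]
  rw [hs]
  exact (Int.modEq_iff_dvd.mp (Int.ModEq.symm hex.choose_spec))

lemma q_dvd (D : ℕ) (hD : 0 < D) (t X : ℤ) (h : (D : ℤ) ∣ t * X) :
    ((D / Int.gcd (D : ℤ) t : ℕ) : ℤ) ∣ X := by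
  have hg : 0 < Int.gcd (D : ℤ) t := Int.gcd_pos_of_ne_zero_left _ (by positivity)
  have hc : IsCoprime ((D : ℤ) / Int.gcd (D : ℤ) t) (t / Int.gcd (D : ℤ) t) :=
    Int.isCoprime_iff_gcd_eq_one.mpr (Int.gcd_div_gcd_div_gcd hg)
  push_cast
  apply hc.dvd_of_dvd_mul_left
  obtain ⟨k, hk⟩ := h
  obtain ⟨a, ha⟩ := Int.gcd_dvd_left (D : ℤ) t
  obtain ⟨b, hb⟩ := Int.gcd_dvd_right (D : ℤ) t
  set g : ℤ := (Int.gcd (D : ℤ) t : ℤ) with hgdef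
  have hg0 : g ≠ 0 := by rw [hgdef]; exact_mod_cast hg.ne'
  have e1 : (D : ℤ) / g = a := by rw [ha]; exact Int.mul_ediv_cancel_left _ hg0
  have e2 : t / g = b := by
    rw [show t / g = (g * b) / g from congrArg (· / g) hb]
    exact Int.mul_ediv_cancel_left _ hg0
  rw [e1, e2]
  refine ⟨k, mul_left_cancel₀ hg0 ?_⟩
  linear_combination hk - X * hb + k * ha

lemma core (D1 : ℕ) (hD1 : 0 < D1) (D2 B1 C1 B2 C2 Y Z r s : ℤ)
    (hrel : (D1 : ℤ) * D2 ∣ D1 * C2 + B1 * B2 + D2 * C1)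
    (hbz : (D1 : ℤ) ∣ Y * B1 + Z * C1 - 1)
    (h1 : (D1 : ℤ) ∣ r * B1) (h2 : (D1 : ℤ) ∣ s * (Y * D2 - Z * B2)) :
    ((D1 / Int.gcd (D1 : ℤ) (r * s) : ℕ) : ℤ) ∣ D1 ∧
    ((D1 / Int.gcd (D1 : ℤ) (r * s) : ℕ) : ℤ) ∣ D2 ∧
    ((D1 / Int.gcd (D1 : ℤ) (r * s) : ℕ) : ℤ) ∣ B1 ∧
    ((D1 / Int.gcd (D1 : ℤ) (r * s) : ℕ) : ℤ) ∣ B2 := by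
  obtain ⟨k, hk⟩ := hrel
  obtain ⟨t, ht⟩ := hbz
  obtain ⟨u, hu⟩ := h1
  obtain ⟨v, hv⟩ := h2
  refine ⟨q_dvd D1 hD1 _ _ ⟨r * s, by ring⟩, q_dvd D1 hD1 _ _ ?_, q_dvd D1 hD1 _ _ ?_,
    q_dvd D1 hD1 _ _ ?_⟩
  · refine ⟨r * B1 * v + r * s * (Z * k * D2 - Z * C2 - t * D2), ?_⟩
    linear_combination r * B1 * hv + r * s * Z * hk - r * s * D2 * ht
  · exact ⟨s * u, by linear_combination s * hu⟩
  · refine ⟨r * (-C1 * v + s * (Y * k * D2 - Y * C2 - t * B2)), ?_⟩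
    linear_combination -r * C1 * hv + r * s * Y * hk - r * s * B2 * ht

lemma Shat_zero (r1 s1 r2 s2 x1 y1 x2 y2 : ℤ) (D1 D2 : ℕ) (hD1 : 0 < D1) (hD2 : 0 < D2)
    (H : ∀ B1 C1 B2 C2 : ℕ, (D1 * D2 ∣ D1 * C2 + B1 * B2 + D2 * C1) →
      Nat.gcd (Nat.gcd B1 C1) D1 = 1 → Nat.gcd (Nat.gcd B2 C2) D2 = 1 →
      ¬ ((D1 : ℤ) ∣ r1 * B1 - y1 ∧
        (D1 : ℤ) ∣ s1 * ((bezout B1 C1 D1).1 * D2 - (bezout B1 C1 D1).2 * B2) - x1 ∧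
        (D2 : ℤ) ∣ s2 * ((bezout B2 C2 D2).1 * D1 - (bezout B2 C2 D2).2 * B1) - y2 ∧
        (D2 : ℤ) ∣ r2 * B2 - x2)) :
    Shat r1 s1 r2 s2 x1 y1 x2 y2 D1 D2 = 0 := by
  unfold Shat longS
  simp_rw [Finset.sum_mul]
  rw [swap4]
  apply mul_eq_zero_of_right
  refine Finset.sum_eq_zero fun B1 _ => Finset.sum_eq_zero fun C1 _ =>
    Finset.sum_eq_zero fun B2 _ => Finset.sum_eq_zero fun C2 _ => ?_
  by_cases hc : (D1 * D2 ∣ D1 * C2 + B1 * B2 + D2 * C1)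
          ∧ Nat.gcd (Nat.gcd B1 C1) D1 = 1 ∧ Nat.gcd (Nat.gcd B2 C2) D2 = 1
  · simp_rw [if_pos hc]
    rw [← four_zero D1 D2 hD1 hD2 _ _ _ _ (H B1 C1 B2 C2 hc.1 hc.2.1 hc.2.2)]
    refine Finset.sum_congr rfl fun n1 _ => Finset.sum_congr rfl fun m1 _ =>
      Finset.sum_congr rfl fun n2 _ => Finset.sum_congr rfl fun m2 _ => ?_
    simp_rw [← eFn_add]
    congr 1
    push_cast
    ring
  · simp_rw [if_neg hc]
    simp

/-- Lemma 7(b) of Blomer–Buttcane: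
`Ŝ_{r₁,s₁,r₂,s₂}(0, 0, x₂, y₂; D₁, D₂) = 0` unless `D₁/(D₁, r₁s₁) ∣ (x₂, y₂)`, and
`Ŝ_{r₁,s₁,r₂,s₂}(x₁, y₁, 0, 0; D₁, D₂) = 0` unless `D₂/(D₂, r₂s₂) ∣ (x₁, y₁)`. -/
theorem statement4 (r1 s1 r2 s2 : ℤ) (hr1 : r1 ≠ 0) (hs1 : s1 ≠ 0) (hr2 : r2 ≠ 0)
    (hs2 : s2 ≠ 0) (D1 D2 : ℕ) (hD1 : 0 < D1) (hD2 : 0 < D2) :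
    (∀ x2 y2 : ℤ,
      ¬(((D1 / Int.gcd (D1 : ℤ) (r1 * s1) : ℕ) : ℤ) ∣ x2 ∧
        ((D1 / Int.gcd (D1 : ℤ) (r1 * s1) : ℕ) : ℤ) ∣ y2) →
      Shat r1 s1 r2 s2 0 0 x2 y2 D1 D2 = 0) ∧
    (∀ x1 y1 : ℤ,
      ¬(((D2 / Int.gcd (D2 : ℤ) (r2 * s2) : ℕ) : ℤ) ∣ x1 ∧
        ((D2 / Int.gcd (D2 : ℤ) (r2 * s2) : ℕ) : ℤ) ∣ y1) →
      Shat r1 s1 r2 s2 x1 y1 0 0 D1 D2 = 0) := by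
  constructor
  · intro x2 y2 hn
    apply Shat_zero _ _ _ _ _ _ _ _ _ _ hD1 hD2
    rintro B1 C1 B2 C2 hrel g1 g2 ⟨h1, h2, h3, h4⟩
    apply hn
    rw [sub_zero] at h1 h2
    obtain ⟨q1, q2, q3, q4⟩ := core D1 hD1 D2 B1 C1 B2 C2 _ _ r1 s1
      (by exact_mod_cast hrel) (bezout_spec B1 C1 D1 g1) h1 h2
    refine ⟨(dvd_sub_right (q4.mul_left r2)).mp (q2.trans h4),
      (dvd_sub_right ?_).mp (q2.trans h3)⟩
    exact (dvd_sub (q1.mul_left _) (q3.mul_left _)).mul_left _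
  · intro x1 y1 hn
    apply Shat_zero _ _ _ _ _ _ _ _ _ _ hD1 hD2
    rintro B1 C1 B2 C2 hrel g1 g2 ⟨h1, h2, h3, h4⟩
    apply hn
    rw [sub_zero] at h3 h4
    have hrel' : (D2 : ℤ) * D1 ∣ D2 * C1 + B2 * B1 + D1 * C2 := by
      have h5 : (D1 : ℤ) * D2 ∣ D1 * C2 + B1 * B2 + D2 * C1 := by exact_mod_cast hrel
      convert h5 using 1 <;> ring
    obtain ⟨q1, q2, q3, q4⟩ := core D2 hD2 D1 B2 C2 B1 C1 _ _ r2 s2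
      hrel' (bezout_spec B2 C2 D2 g2) h4 h3
    refine ⟨(dvd_sub_right ?_).mp (q2.trans h2),
      (dvd_sub_right (q4.mul_left r1)).mp (q2.trans h1)⟩
    exact (dvd_sub (q1.mul_left _) (q3.mul_left _)).mul_left _
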